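/- arXiv:0911.4185 — 2 statements merged into one kernel-verified Lean document; each statement's English description precedes it below -/
import Mathlib

section
/- Let G be a group and H a normal subgroup of finite index in G such that the center Z(H) is a free abelian group of finite rank and the quotient H/Z(H) is a free abelian group of finite rank. Then G is Hopfian. -/
/-- Noetherianity of the subgroup lattice passes to group extensions. -/
theorem Subgroup.wellFoundedGT_of_normal {G : Type*} [Group G] (N : Subgroup G) [N.Normal]
    [WellFoundedGT (Subgroup N)] [WellFoundedGT (Subgroup (G ⧸ N))] :
    WellFoundedGT (Subgroup G) := by
  let φ : Subgroup G → Subgroup N × Subgroup (G ⧸ N) :=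
    fun K ↦ (K.subgroupOf N, K.map (QuotientGroup.mk' N))
  have hmono : Monotone φ := fun K L h ↦
    ⟨Subgroup.comap_mono h, Subgroup.map_mono h⟩
  have hφ : StrictMono φ := by
    refine fun K L h ↦ lt_of_le_not_ge (hmono h.le) fun hle ↦ h.not_ge fun x hx ↦ ?_
    obtain ⟨y, hy, hyx⟩ := hle.2 (Subgroup.mem_map_of_mem (QuotientGroup.mk' N) hx)
    have hN : y⁻¹ * x ∈ N := QuotientGroup.eq.mp hyx
    have hK : y⁻¹ * x ∈ K := hle.1 (x := ⟨y⁻¹ * x, hN⟩) (L.mul_mem (L.inv_mem (h.le hy)) hx)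
    simpa using K.mul_mem hy hK
  exact hφ.wellFoundedGT

theorem MulEquiv.wellFoundedGT_subgroup {A B : Type*} [Group A] [Group B] (e : A ≃* B)
    [WellFoundedGT (Subgroup B)] : WellFoundedGT (Subgroup A) :=
  e.mapSubgroup.strictMono.wellFoundedGT

instance Multiplicative.wellFoundedGT_subgroup {M : Type*} [AddCommGroup M] [IsNoetherian ℤ M] :
    WellFoundedGT (Subgroup (Multiplicative M)) :=
  (Subgroup.toAddSubgroup'.trans AddSubgroup.toIntSubmodule).strictMono.wellFoundedGT

/-- A group with Noetherian subgroup lattice is Hopfian. -/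
theorem MonoidHom.injective_of_surjective_of_wellFoundedGT {G : Type*} [Group G]
    [WellFoundedGT (Subgroup G)] (f : G →* G) (hf : Function.Surjective f) :
    Function.Injective f := by
  rw [← f.ker_eq_bot_iff, ← MonoidHom.comap_bot]
  by_contra hne
  have hcomap : StrictMono (Subgroup.comap f) :=
    Monotone.strictMono_of_injective (fun _ _ h ↦ Subgroup.comap_mono h)
      (Subgroup.comap_injective hf)
  have hchain := hcomap.strictMono_iterate_of_lt_map (bot_lt_iff_ne_bot.mpr hne)
  obtain ⟨n, hn⟩ := WellFoundedGT.monotone_chain_condition ⟨_, hchain.monotone⟩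
  exact (hchain n.lt_succ_self).ne (hn _ n.le_succ)

/-- A group `G` with a normal subgroup `H` of finite index such that the center `Z(H)`
is free abelian of finite rank and `H/Z(H)` is free abelian of finite rank is Hopfian:
every surjective endomorphism of `G` is injective. -/
theorem aew_hopfian {G : Type*} [Group G] (H : Subgroup G) [H.Normal] [H.FiniteIndex]
    (hZ : ∃ n : ℕ, Nonempty (Subgroup.center H ≃* Multiplicative (Fin n → ℤ)))
    (hQ : ∃ n : ℕ, Nonempty ((H ⧸ Subgroup.center H) ≃* Multiplicative (Fin n → ℤ))) :
    ∀ f : G →* G, Function.Surjective f → Function.Injective f := by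
  obtain ⟨_, ⟨eZ⟩⟩ := hZ
  obtain ⟨_, ⟨eQ⟩⟩ := hQ
  have := eZ.wellFoundedGT_subgroup
  have := eQ.wellFoundedGT_subgroup
  have := Subgroup.wellFoundedGT_of_normal (Subgroup.center H)
  have := Subgroup.wellFoundedGT_of_normal H
  exact fun f hf ↦ f.injective_of_surjective_of_wellFoundedGT hf
end

section
/- Each of the following elements of Ŵ is central in Ŵ: (i) the commutator [t̂_α^σ, t̂_β^δ], for α, β ∈ R and σ, δ ∈ V⁰ with α+σ ∈ R and β+δ ∈ R; (ii) t̂_{α+σ}^δ · t̂_α^{−δ}, for α ∈ R and σ, δ ∈ V⁰ with α+σ, α+δ, α+σ+δ ∈ R; (iii) t̂_α^{−(δ₁+⋯+δ_n)} · t̂_α^{δ₁} ⋯ t̂_α^{δ_n}, for α ∈ R and δ₁, …, δ_n ∈ V⁰ with α+δ_r ∈ R for each r and α+(δ₁+⋯+δ_n) ∈ R. -/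
/-- The reflection `s_α(u) = u - (u, α^∨) α` associated to a vector `α`, where
`α^∨ = 2α/(α,α)` and `B` is the bilinear form. -/
noncomputable def reflMap {V : Type*} [AddCommGroup V] [Module ℝ V] (B : V →ₗ[ℝ] V →ₗ[ℝ] ℝ)
    (α : V) : V → V :=
  fun u => u - ((2 * B u α) / B α α) • α

/-- The defining relations of the presented group `Ŵ`: (I) `ŵ_α² = 1` and
(II) `ŵ_α ŵ_β ŵ_α = ŵ_{s_α(β)}` for `α, β ∈ R`. -/
def eawRels {V : Type*} [AddCommGroup V] [Module ℝ V] (B : V →ₗ[ℝ] V →ₗ[ℝ] ℝ)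
    (R : Set V) : Set (FreeGroup R) :=
  {r | ∃ α : R, r = FreeGroup.of α * FreeGroup.of α} ∪
  {r | ∃ α β γ : R, (γ : V) = reflMap B (α : V) (β : V) ∧
        r = FreeGroup.of α * FreeGroup.of β * FreeGroup.of α * (FreeGroup.of γ)⁻¹}

/-- The group `Ŵ` presented by generators `ŵ_α` (`α ∈ R`) and relations (I), (II). -/
abbrev EAW {V : Type*} [AddCommGroup V] [Module ℝ V] (B : V →ₗ[ℝ] V →ₗ[ℝ] ℝ)
    (R : Set V) :=
  PresentedGroup (eawRels B R)

/-- The generator `ŵ_α` of `Ŵ`. -/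
def wgen {V : Type*} [AddCommGroup V] [Module ℝ V] (B : V →ₗ[ℝ] V →ₗ[ℝ] ℝ)
    (R : Set V) (α : V) (hα : α ∈ R) : EAW B R :=
  PresentedGroup.of (⟨α, hα⟩ : R)

/-- The element `t̂_α^σ = ŵ_{α+σ} ŵ_α` of `Ŵ`. -/
def tgen {V : Type*} [AddCommGroup V] [Module ℝ V] (B : V →ₗ[ℝ] V →ₗ[ℝ] ℝ)
    (R : Set V) (α σ : V) (hα : α ∈ R) (hασ : α + σ ∈ R) : EAW B R :=
  wgen B R (α + σ) hασ * wgen B R α hα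

section ActsBy

variable {V : Type*} [AddCommGroup V] [Module ℝ V] {B : V →ₗ[ℝ] V →ₗ[ℝ] ℝ} {R : Set V}

/-- Conjugation by `x` permutes the generators `ŵ_β` through the map `f` on `R`. -/
def ActsBy (x : EAW B R) (f : V → V) : Prop :=
  ∀ (β : V) (hβ : β ∈ R), ∃ h : f β ∈ R, x * wgen B R β hβ = wgen B R (f β) h * x

/-- The map `u ↦ u + (u, α^∨) σ`, a transvection when `σ` is isotropic. -/
noncomputable def transl (B : V →ₗ[ℝ] V →ₗ[ℝ] ℝ) (α σ : V) : V → V :=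
  fun u => u + ((2 * B u α) / B α α) • σ

theorem wgen_mul_self {α : V} (hα : α ∈ R) : wgen B R α hα * wgen B R α hα = 1 :=
  PresentedGroup.one_of_mem (rels := eawRels B R) (Or.inl ⟨⟨α, hα⟩, rfl⟩)

theorem wgen_inv {α : V} (hα : α ∈ R) : (wgen B R α hα)⁻¹ = wgen B R α hα :=
  inv_eq_of_mul_eq_one_left (wgen_mul_self hα)

theorem wgen_conj {α β : V} (hα : α ∈ R) (hβ : β ∈ R) (h : reflMap B α β ∈ R) :
    wgen B R α hα * wgen B R β hβ * wgen B R α hα = wgen B R (reflMap B α β) h :=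
  mul_inv_eq_one.mp (PresentedGroup.one_of_mem (rels := eawRels B R)
    (Or.inr ⟨⟨α, hα⟩, ⟨β, hβ⟩, ⟨_, h⟩, rfl, rfl⟩))

theorem ActsBy.mul {x y : EAW B R} {f g : V → V} (hx : ActsBy x f) (hy : ActsBy y g) :
    ActsBy (x * y) (f ∘ g) := by
  intro β hβ
  obtain ⟨h₁, e₁⟩ := hy β hβ
  obtain ⟨h₂, e₂⟩ := hx _ h₁
  exact ⟨h₂, by rw [mul_assoc, e₁, ← mul_assoc, e₂, mul_assoc]; rfl⟩

theorem ActsBy.congr {x : EAW B R} {f g : V → V} (hx : ActsBy x f) (h : ∀ u, f u = g u) :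
    ActsBy x g :=
  (funext h : f = g) ▸ hx

theorem actsBy_one : ActsBy (1 : EAW B R) id := fun β hβ => ⟨hβ, by simp⟩

theorem ActsBy.mem_center {x : EAW B R} (hx : ActsBy x id) : x ∈ Subgroup.center (EAW B R) := by
  rw [← Subgroup.centralizer_univ, ← Subgroup.coe_top,
    ← PresentedGroup.closure_range_of (eawRels B R), Subgroup.centralizer_closure,
    Subgroup.mem_centralizer_iff]
  rintro _ ⟨β, rfl⟩
  obtain ⟨_, e⟩ := hx β β.2
  exact e.symm

theorem actsBy_wgen (hclos : ∀ α ∈ R, ∀ β ∈ R, reflMap B α β ∈ R) {α : V} (hα : α ∈ R) :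
    ActsBy (wgen B R α hα) (reflMap B α) := by
  intro β hβ
  refine ⟨hclos α hα β hβ, ?_⟩
  rw [← wgen_conj hα hβ, mul_assoc _ (wgen B R α hα), wgen_mul_self, mul_one]

theorem transl_transl {α σ β δ : V} (hδ : ∀ u : V, B δ u = 0) (u : V) :
    transl B α σ (transl B β δ u) =
      u + ((2 * B u β) / B β β) • δ + ((2 * B u α) / B α α) • σ := by
  simp [transl, hδ]

theorem transl_add_left {α σ : V} (hsym : ∀ u v : V, B u v = B v u)
    (hσ : ∀ u : V, B σ u = 0) (δ u : V) : transl B (α + σ) δ u = transl B α δ u := by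
  have hσ' : ∀ u, B u σ = 0 := fun u => (hsym u σ).trans (hσ u)
  simp [transl, hσ, hσ']

theorem reflMap_add_reflMap {α σ : V} (hsym : ∀ u v : V, B u v = B v u) (hα : B α α ≠ 0)
    (hσ : ∀ u : V, B σ u = 0) (u : V) :
    reflMap B (α + σ) (reflMap B α u) = transl B α σ u := by
  have hσ' : ∀ u, B u σ = 0 := fun u => (hsym u σ).trans (hσ u)
  simp only [reflMap, transl, map_add, map_sub, map_smul, LinearMap.add_apply,
    LinearMap.sub_apply, LinearMap.smul_apply, hσ, hσ', smul_eq_mul, add_zero]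
  match_scalars <;> field_simp <;> ring

theorem reflMap_reflMap_add {α σ : V} (hsym : ∀ u v : V, B u v = B v u) (hα : B α α ≠ 0)
    (hσ : ∀ u : V, B σ u = 0) (u : V) :
    reflMap B α (reflMap B (α + σ) u) = transl B α (-σ) u := by
  have hσ' : ∀ u, B u σ = 0 := fun u => (hsym u σ).trans (hσ u)
  simp only [reflMap, transl, map_add, map_sub, map_smul, LinearMap.add_apply,
    LinearMap.sub_apply, LinearMap.smul_apply, hσ, hσ', smul_eq_mul, add_zero]
  match_scalars <;> field_simp <;> ring

theorem add_neg_mem {α σ : V} (hnon : ∀ α ∈ R, B α α ≠ 0)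
    (hclos : ∀ α ∈ R, ∀ β ∈ R, reflMap B α β ∈ R) (hα : α ∈ R) (hσ : ∀ u : V, B σ u = 0)
    (hασ : α + σ ∈ R) : α + -σ ∈ R := by
  have hneg : ∀ γ ∈ R, -γ ∈ R := by
    intro γ hγ
    have h := hclos γ hγ γ hγ
    rw [reflMap, mul_div_assoc, div_self (hnon γ hγ)] at h
    convert h using 1
    module
  have h := hneg _ (hclos α hα _ hασ)
  rw [reflMap, map_add, LinearMap.add_apply, hσ, add_zero, mul_div_assoc,
    div_self (hnon α hα)] at h
  convert h using 1
  module

theorem actsBy_tgen (hsym : ∀ u v : V, B u v = B v u) (hnon : ∀ α ∈ R, B α α ≠ 0)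
    (hclos : ∀ α ∈ R, ∀ β ∈ R, reflMap B α β ∈ R) {α σ : V} (hα : α ∈ R)
    (hσ : ∀ u : V, B σ u = 0) (hασ : α + σ ∈ R) :
    ActsBy (tgen B R α σ hα hασ) (transl B α σ) :=
  ((actsBy_wgen hclos hασ).mul (actsBy_wgen hclos hα)).congr
    (reflMap_add_reflMap hsym (hnon α hα) hσ)

theorem actsBy_tgen_inv (hsym : ∀ u v : V, B u v = B v u) (hnon : ∀ α ∈ R, B α α ≠ 0)
    (hclos : ∀ α ∈ R, ∀ β ∈ R, reflMap B α β ∈ R) {α σ : V} (hα : α ∈ R)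
    (hσ : ∀ u : V, B σ u = 0) (hασ : α + σ ∈ R) :
    ActsBy (tgen B R α σ hα hασ)⁻¹ (transl B α (-σ)) := by
  rw [tgen, mul_inv_rev, wgen_inv, wgen_inv]
  exact ((actsBy_wgen hclos hα).mul (actsBy_wgen hclos hασ)).congr
    (reflMap_reflMap_add hsym (hnon α hα) hσ)

theorem isotropic_sum {n : ℕ} {δs : Fin n → V} (hδ : ∀ r : Fin n, ∀ u : V, B (δs r) u = 0)
    (u : V) : B (∑ r, δs r) u = 0 := by
  simp [hδ]

theorem actsBy_prod_tgen (hsym : ∀ u v : V, B u v = B v u) (hnon : ∀ α ∈ R, B α α ≠ 0)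
    (hclos : ∀ α ∈ R, ∀ β ∈ R, reflMap B α β ∈ R) {α : V} (hα : α ∈ R) :
    ∀ (n : ℕ) (δs : Fin n → V), (∀ r : Fin n, ∀ u : V, B (δs r) u = 0) →
      ∀ hmem : ∀ r : Fin n, α + δs r ∈ R,
        ActsBy (List.ofFn fun r : Fin n => tgen B R α (δs r) hα (hmem r)).prod
          (transl B α (∑ r, δs r))
  | 0, _, _, _ => by
    simpa using actsBy_one.congr (fun u => by simp [transl])
  | n + 1, δs, hδ, hmem => by
    rw [List.ofFn_succ, List.prod_cons, Fin.sum_univ_succ]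
    refine ((actsBy_tgen hsym hnon hclos hα (hδ 0) (hmem 0)).mul
      (actsBy_prod_tgen hsym hnon hclos hα n (fun r => δs r.succ) (fun r => hδ r.succ)
        (fun r => hmem r.succ))).congr fun u => ?_
    rw [Function.comp_apply, transl_transl (isotropic_sum fun r => hδ r.succ), transl]
    module

end ActsBy

/-- Each of the following elements of `Ŵ` is central: (i) the commutator
`[t̂_α^σ, t̂_β^δ] = (t̂_α^σ)⁻¹ (t̂_β^δ)⁻¹ t̂_α^σ t̂_β^δ`; (ii) `t̂_{α+σ}^δ · t̂_α^{−δ}`;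
(iii) `t̂_α^{−(δ₁+⋯+δ_n)} · t̂_α^{δ₁} ⋯ t̂_α^{δ_n}`. -/
theorem central_elements {V : Type*} [AddCommGroup V] [Module ℝ V]
    (B : V →ₗ[ℝ] V →ₗ[ℝ] ℝ) (R : Set V)
    (hsym : ∀ u v : V, B u v = B v u)
    (hpsd : ∀ v : V, 0 ≤ B v v)
    (hnon : ∀ α ∈ R, B α α ≠ 0)
    (hclos : ∀ α ∈ R, ∀ β ∈ R, reflMap B α β ∈ R) :
    -- (i)
    (∀ (α β σ δ : V) (hα : α ∈ R) (hβ : β ∈ R),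
        (∀ u : V, B σ u = 0) → (∀ u : V, B δ u = 0) →
        ∀ (hασ : α + σ ∈ R) (hβδ : β + δ ∈ R),
          (tgen B R α σ hα hασ)⁻¹ * (tgen B R β δ hβ hβδ)⁻¹ *
              tgen B R α σ hα hασ * tgen B R β δ hβ hβδ ∈
            Subgroup.center (EAW B R)) ∧
    -- (ii)
    (∀ (α σ δ : V) (hα : α ∈ R),
        (∀ u : V, B σ u = 0) → (∀ u : V, B δ u = 0) →
        ∀ (hασ : α + σ ∈ R) (hαδ : α + δ ∈ R) (hασδ : α + σ + δ ∈ R),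
          ∃ hnd : α + -δ ∈ R,
            tgen B R (α + σ) δ hασ hασδ * tgen B R α (-δ) hα hnd ∈
              Subgroup.center (EAW B R)) ∧
    -- (iii)
    (∀ (α : V) (hα : α ∈ R) (n : ℕ) (δs : Fin n → V),
        (∀ r : Fin n, ∀ u : V, B (δs r) u = 0) →
        ∀ (hmem : ∀ r : Fin n, α + δs r ∈ R), (α + ∑ r : Fin n, δs r ∈ R) →
          ∃ hns : α + -(∑ r : Fin n, δs r) ∈ R,
            tgen B R α (-(∑ r : Fin n, δs r)) hα hns *
                (List.ofFn fun r : Fin n => tgen B R α (δs r) hα (hmem r)).prod ∈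
              Subgroup.center (EAW B R)) := by
  refine ⟨?_, ?_, ?_⟩
  · intro α β σ δ hα hβ hσ hδ hασ hβδ
    have hσ' : ∀ u : V, B (-σ) u = 0 := by simp [hσ]
    have hδ' : ∀ u : V, B (-δ) u = 0 := by simp [hδ]
    refine ActsBy.mem_center (((((actsBy_tgen_inv hsym hnon hclos hα hσ hασ).mul
      (actsBy_tgen_inv hsym hnon hclos hβ hδ hβδ)).mul
      (actsBy_tgen hsym hnon hclos hα hσ hασ)).mul
      (actsBy_tgen hsym hnon hclos hβ hδ hβδ)).congr fun u => ?_)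
    simp only [Function.comp_apply, transl, map_add, map_smul, LinearMap.add_apply,
      LinearMap.smul_apply, hσ, hδ, hδ', smul_eq_mul, mul_zero, add_zero, id]
    module
  · intro α σ δ hα hσ hδ hασ hαδ hασδ
    have hδ' : ∀ u : V, B (-δ) u = 0 := by simp [hδ]
    have hnd := add_neg_mem hnon hclos hα hδ hαδ
    refine ⟨hnd, ActsBy.mem_center (((actsBy_tgen hsym hnon hclos hασ hδ hασδ).mul
      (actsBy_tgen hsym hnon hclos hα hδ' hnd)).congr fun u => ?_)⟩
    rw [Function.comp_apply, transl_add_left hsym hσ, transl_transl hδ', id]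
    module
  · intro α hα n δs hδ hmem hsum
    have hs := isotropic_sum hδ
    have hs' : ∀ u : V, B (-∑ r, δs r) u = 0 := fun u => by
      rw [map_neg, LinearMap.neg_apply, hs, neg_zero]
    have hns := add_neg_mem hnon hclos hα hs hsum
    refine ⟨hns, ActsBy.mem_center (((actsBy_tgen hsym hnon hclos hα hs' hns).mul
      (actsBy_prod_tgen hsym hnon hclos hα n δs hδ hmem)).congr fun u => ?_)⟩
    rw [Function.comp_apply, transl_transl hs, id]
    module
end
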